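/- Assume (f_n) is a sequence of monotone non-expansive functions f_n : X → X converging pointwise to a function f : X → X which has at least one fixpoint, let ((α_n),(β_n)) be an exact Mann scheme, let x_0 ∈ X, and let (x_n) be the dampened Mann iteration with function sequence (f_n). If (f_n) converges normally to f, i.e. Σ_{n∈ℕ} sup_{x∈X} ‖f(x) − f_n(x)‖ < ∞, then (x_n) converges to μf. -/

import Mathlib

open Filter Set Topology

/-- The dampened Mann iteration:
`x₀ = x0`, `x_{n+1} = (1 - β n) • (α n • x n + (1 - α n) • f n (x n))`. -/
noncomputable def mannSeq {E : Type*} [AddCommGroup E] [Module ℝ E]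
    (α β : ℕ → ℝ) (f : ℕ → E → E) (x0 : E) : ℕ → E
  | 0 => x0
  | n + 1 => (1 - β n) • (α n • mannSeq α β f x0 n + (1 - α n) • f n (mannSeq α β f x0 n))

/-- An exact Mann scheme: a pair of sequences in `[0,1)` with `β n → 0` and
`Σ β n = ∞` such that, for every dimension `d`, every closed convex set
`X ⊆ ℝ^d` of non-negative vectors containing `0`, every monotone non-expansive
`g : X → X` with at least one fixpoint and every starting point in `X`, the
dampened Mann iteration with the constant function sequence `g` converges to
the least fixpoint of `g`. -/
def ExactScheme (α β : ℕ → ℝ) : Prop :=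
  (∀ n, α n ∈ Set.Ico (0 : ℝ) 1) ∧ (∀ n, β n ∈ Set.Ico (0 : ℝ) 1) ∧
  Tendsto β atTop (nhds 0) ∧ ¬ Summable β ∧
  ∀ (d : ℕ) (X : Set (Fin d → ℝ)), IsClosed X → Convex ℝ X →
    (∀ x ∈ X, ∀ i, 0 ≤ x i) → (0 : Fin d → ℝ) ∈ X →
    ∀ g : (Fin d → ℝ) → (Fin d → ℝ), Set.MapsTo g X X →
      (∀ x ∈ X, ∀ y ∈ X, x ≤ y → g x ≤ g y) → LipschitzOnWith 1 g X →
      (∃ x ∈ X, g x = x) →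
      ∀ μ, IsLeast {x | x ∈ X ∧ g x = x} μ →
        ∀ x0 ∈ X, Tendsto (mannSeq α β (fun _ => g) x0) atTop (nhds μ)

/-- A non-negative sequence contracted by factors `1 - β n` with `Σ β n = ∞`, up to summable
errors, tends to zero. -/
theorem tendsto_zero_of_le_one_sub_mul_add {a β e : ℕ → ℝ} (ha : ∀ n, 0 ≤ a n)
    (hβ0 : ∀ n, 0 ≤ β n) (hβ1 : ∀ n, β n ≤ 1) (hβ : ¬ Summable β)
    (he0 : ∀ n, 0 ≤ e n) (he : Summable e)
    (h : ∀ n, a (n + 1) ≤ (1 - β n) * a n + e n) : Tendsto a atTop (𝓝 0) := by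
  have key : ∀ N m, a (m + N) ≤ Real.exp (-∑ i ∈ Finset.range m, β (i + N)) * a N
      + ∑ i ∈ Finset.range m, e (i + N) := by
    intro N m
    induction m with
    | zero => simp
    | succ m ih =>
      have hS : 0 ≤ ∑ i ∈ Finset.range m, e (i + N) := Finset.sum_nonneg fun i _ => he0 _
      have h1 : 0 ≤ 1 - β (m + N) := by linarith [hβ1 (m + N)]
      have h2 : 1 - β (m + N) ≤ Real.exp (-β (m + N)) := Real.one_sub_le_exp_neg _
      have h3 : 0 ≤ Real.exp (-∑ i ∈ Finset.range m, β (i + N)) * a N :=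
        mul_nonneg (Real.exp_nonneg _) (ha N)
      rw [Finset.sum_range_succ, Finset.sum_range_succ, neg_add, Real.exp_add]
      have h4 := h (m + N)
      rw [show m + N + 1 = m + 1 + N by ring] at h4
      have h5 := mul_le_mul_of_nonneg_left ih h1
      have h6 := mul_le_mul_of_nonneg_right h2 h3
      have h7 : (1 - β (m + N)) * ∑ i ∈ Finset.range m, e (i + N)
          ≤ ∑ i ∈ Finset.range m, e (i + N) :=
        mul_le_of_le_one_left hS (by linarith [hβ0 (m + N)])
      linarith
  rw [Metric.tendsto_atTop]
  intro ε hε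
  obtain ⟨N, hN⟩ := ((tendsto_order.1 (tendsto_sum_nat_add e)).2 (ε / 2) (half_pos hε)).exists
  have hdiv : Tendsto (fun m => ∑ i ∈ Finset.range m, β (i + N)) atTop atTop :=
    (not_summable_iff_tendsto_nat_atTop_of_nonneg fun i => hβ0 _).1
      (mt (summable_nat_add_iff N).1 hβ)
  have hexp : Tendsto (fun m => Real.exp (-∑ i ∈ Finset.range m, β (i + N)) * a N)
      atTop (𝓝 0) := by
    simpa using (Real.tendsto_exp_neg_atTop_nhds_zero.comp hdiv).mul_const (a N)
  obtain ⟨M, hM⟩ := eventually_atTop.1 ((tendsto_order.1 hexp).2 (ε / 2) (half_pos hε))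
  refine ⟨M + N, fun n hn => ?_⟩
  obtain ⟨m, rfl⟩ : ∃ m, n = m + N := ⟨n - N, by omega⟩
  have hsum : ∑ i ∈ Finset.range m, e (i + N) ≤ ∑' i, e (i + N) :=
    ((summable_nat_add_iff N).2 he).sum_le_tsum _ fun i _ => he0 _
  rw [Real.dist_eq, sub_zero, abs_of_nonneg (ha _)]
  linarith [key N m, hM m (by omega)]

/-- The dampened Mann iteration stays in a convex set containing `0`. -/
theorem mannSeq_mem {E : Type*} [AddCommGroup E] [Module ℝ E] {α β : ℕ → ℝ}
    (hα : ∀ n, α n ∈ Set.Icc (0 : ℝ) 1) (hβ : ∀ n, β n ∈ Set.Icc (0 : ℝ) 1)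
    {X : Set E} (hX : Convex ℝ X) (h0 : (0 : E) ∈ X) {f : ℕ → E → E}
    (hf : ∀ n, Set.MapsTo (f n) X X) {x0 : E} (hx0 : x0 ∈ X) (n : ℕ) :
    mannSeq α β f x0 n ∈ X := by
  induction n with
  | zero => exact hx0
  | succ n ih =>
    rw [mannSeq]
    exact hX.smul_mem_of_zero_mem h0
      (hX ih (hf n ih) (hα n).1 (sub_nonneg.2 (hα n).2) (by ring))
      ⟨sub_nonneg.2 (hβ n).2, by linarith [(hβ n).1]⟩

/-- One step of the comparison between two dampened Mann iterations. -/
theorem norm_mannSeq_succ_sub_le {E : Type*} [SeminormedAddCommGroup E] [NormedSpace ℝ E]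
    {α β : ℕ → ℝ} (hα : ∀ n, α n ∈ Set.Icc (0 : ℝ) 1) (hβ : ∀ n, β n ∈ Set.Icc (0 : ℝ) 1)
    {f g : ℕ → E → E} {x0 y0 : E} {n : ℕ} {e : ℝ} (he : 0 ≤ e)
    (h : ‖f n (mannSeq α β f x0 n) - g n (mannSeq α β g y0 n)‖
      ≤ ‖mannSeq α β f x0 n - mannSeq α β g y0 n‖ + e) :
    ‖mannSeq α β f x0 (n + 1) - mannSeq α β g y0 (n + 1)‖
      ≤ (1 - β n) * ‖mannSeq α β f x0 n - mannSeq α β g y0 n‖ + e := by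
  rw [mannSeq, mannSeq]
  generalize mannSeq α β f x0 n = x at *
  generalize mannSeq α β g y0 n = y at *
  obtain ⟨hα0, hα1⟩ := hα n
  obtain ⟨hβ0, hβ1⟩ := hβ n
  have hβ' : 0 ≤ 1 - β n := sub_nonneg.2 hβ1
  have hα' : 0 ≤ 1 - α n := sub_nonneg.2 hα1
  have hinner : ‖α n • (x - y) + (1 - α n) • (f n x - g n y)‖ ≤ ‖x - y‖ + e := by
    refine (norm_add_le _ _).trans ?_
    rw [norm_smul, norm_smul, Real.norm_of_nonneg hα0, Real.norm_of_nonneg hα']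
    nlinarith [mul_le_mul_of_nonneg_left h hα', mul_nonneg hα0 he]
  calc _ = ‖(1 - β n) • (α n • (x - y) + (1 - α n) • (f n x - g n y))‖ := by
        congr 1; module
    _ = (1 - β n) * ‖α n • (x - y) + (1 - α n) • (f n x - g n y)‖ := by
        rw [norm_smul, Real.norm_of_nonneg hβ']
    _ ≤ (1 - β n) * (‖x - y‖ + e) := mul_le_mul_of_nonneg_left hinner hβ'
    _ ≤ _ := by nlinarith [mul_nonneg hβ0 he]

/-- for an exact Mann scheme and monotone non-expansive
approximations `fn` converging *normally* to `f`
(`Σₙ sup_{x ∈ X} ‖f x - fn n x‖ < ∞`), the dampened Mann iteration converges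
to `μ f`. -/
theorem mann_convergence_normal_approximations
    (α β : ℕ → ℝ) (hexact : ExactScheme α β)
    (d : ℕ) (X : Set (Fin d → ℝ)) (hX : IsClosed X) (hXc : Convex ℝ X)
    (hpos : ∀ x ∈ X, ∀ i, 0 ≤ x i) (h0 : (0 : Fin d → ℝ) ∈ X)
    (fn : ℕ → (Fin d → ℝ) → (Fin d → ℝ))
    (hfnmap : ∀ n, Set.MapsTo (fn n) X X)
    (hfnmono : ∀ n, ∀ x ∈ X, ∀ y ∈ X, x ≤ y → fn n x ≤ fn n y)
    (hfnne : ∀ n, LipschitzOnWith 1 (fn n) X)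
    (f : (Fin d → ℝ) → (Fin d → ℝ)) (hmap : Set.MapsTo f X X)
    (hconv : ∀ x ∈ X, Tendsto (fun n => fn n x) atTop (nhds (f x)))
    (hfix : ∃ x ∈ X, f x = x)
    (hnormal : ∃ e : ℕ → ℝ, Summable e ∧ ∀ n, ∀ x ∈ X, ‖f x - fn n x‖ ≤ e n)
    (μ : Fin d → ℝ) (hμ : IsLeast {x | x ∈ X ∧ f x = x} μ)
    (x0 : Fin d → ℝ) (hx0 : x0 ∈ X) :
    Tendsto (mannSeq α β fn x0) atTop (nhds μ) := by
  obtain ⟨hα, hβ, -, hβsum, hlim⟩ := hexact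
  obtain ⟨e, he, hfe⟩ := hnormal
  have hα' : ∀ n, α n ∈ Set.Icc (0 : ℝ) 1 := fun n => Set.Ico_subset_Icc_self (hα n)
  have hβ' : ∀ n, β n ∈ Set.Icc (0 : ℝ) 1 := fun n => Set.Ico_subset_Icc_self (hβ n)
  have hfmono : ∀ x ∈ X, ∀ y ∈ X, x ≤ y → f x ≤ f y := fun x hx y hy hxy =>
    le_of_tendsto_of_tendsto' (hconv x hx) (hconv y hy) fun n => hfnmono n x hx y hy hxy
  have hfne : LipschitzOnWith 1 f X := LipschitzOnWith.of_dist_le_mul fun x hx y hy =>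
    le_of_tendsto' ((hconv x hx).dist (hconv y hy)) fun n => (hfnne n).dist_le_mul x hx y hy
  have hy := hlim d X hX hXc hpos h0 f hmap hfmono hfne hfix μ hμ x0 hx0
  have he0 : ∀ n, 0 ≤ e n := fun n => (norm_nonneg _).trans (hfe n 0 h0)
  have hdiff : Tendsto
      (fun n => ‖mannSeq α β fn x0 n - mannSeq α β (fun _ => f) x0 n‖) atTop (𝓝 0) := by
    refine tendsto_zero_of_le_one_sub_mul_add (fun n => norm_nonneg _) (fun n => (hβ' n).1)
      (fun n => (hβ' n).2) hβsum he0 he fun n => norm_mannSeq_succ_sub_le hα' hβ' (he0 n) ?_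
    have hxn := mannSeq_mem hα' hβ' hXc h0 hfnmap hx0 n
    have hyn := mannSeq_mem hα' hβ' hXc h0 (fun _ => hmap) hx0 n
    have h1 := (hfnne n).norm_sub_le hxn hyn
    have h2 := hfe n _ hyn
    rw [norm_sub_rev] at h2
    rw [NNReal.coe_one, one_mul] at h1
    exact (norm_sub_le_norm_sub_add_norm_sub _ _ _).trans (add_le_add h1 h2)
  simpa using (tendsto_zero_iff_norm_tendsto_zero.2 hdiff).add hy
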